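/- Let p and q be distinct odd primes, and let G̃ be the group generated by ε, σ_p, σ_q with ε central of order 2, σ_p σ_q = σ_q σ_p ε, σ_p of order 2(p−1) with σ_p^{p−1} = ε, and σ_q of order 2(q−1) with σ_q^{q−1} = ε. Assume v₂(p−1) ≤ v₂(q−1), where v₂ denotes the 2-adic valuation. Set d = gcd((p−1)/2, q−1) and s = (p−1)/(2d). Then the subgroup N generated by σ_p² and σ_q is abelian of index 2 in G̃, and N ≅ ℤ/d ⊕ ℤ/(2s(q−1)). -/

import Mathlib

/-- Relators for the group generated by `ε` (index 0), `σ_p` (index 1), `σ_q` (index 2)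
subject to: `ε` central, `ε² = 1`, `σ_p σ_q = σ_q σ_p ε`, `σ_p` of order `2(p-1)` with
`σ_p^{p-1} = ε`, and `σ_q` of order `2(q-1)` with `σ_q^{q-1} = ε` (Case C of the paper). -/
def stmt3Rels (p q : ℕ) : Set (FreeGroup (Fin 3)) :=
  { (FreeGroup.of 0) ^ 2,
    (FreeGroup.of 0) * (FreeGroup.of 1) * (FreeGroup.of 0)⁻¹ * (FreeGroup.of 1)⁻¹,
    (FreeGroup.of 0) * (FreeGroup.of 2) * (FreeGroup.of 0)⁻¹ * (FreeGroup.of 2)⁻¹,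
    (FreeGroup.of 1) ^ (2 * (p - 1)),
    (FreeGroup.of 1) ^ (p - 1) * (FreeGroup.of 0)⁻¹,
    (FreeGroup.of 2) ^ (2 * (q - 1)),
    (FreeGroup.of 2) ^ (q - 1) * (FreeGroup.of 0)⁻¹,
    (FreeGroup.of 1) * (FreeGroup.of 2) *
      ((FreeGroup.of 2) * (FreeGroup.of 1) * (FreeGroup.of 0))⁻¹ }

/-- shift permutation -/
def s3T (A : Type) [AddCommGroup A] : Multiplicative (Bool → A) →* Equiv.Perm (A × Bool) where
  toFun f :=
    { toFun := fun x => (x.1 + f.toAdd x.2, x.2)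
      invFun := fun x => (x.1 - f.toAdd x.2, x.2)
      left_inv := fun x => by simp
      right_inv := fun x => by simp }
  map_one' := by ext x <;> simp
  map_mul' f g := by
    ext x
    · simp [add_comm, add_left_comm]
    · simp

/-- image of the first generator -/
def s3P (A : Type) [AddCommGroup A] (a : A) : Equiv.Perm (A × Bool) where
  toFun := fun x => (x.1 + (if x.2 then a else 0), !x.2)
  invFun := fun x => (x.1 - (if x.2 then 0 else a), !x.2)
  left_inv := fun x => by rcases x with ⟨x, _ | _⟩ <;> simp
  right_inv := fun x => by rcases x with ⟨x, _ | _⟩ <;> simp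

theorem s3T_apply (A : Type) [AddCommGroup A] (f : Bool → A) (x : A × Bool) :
    s3T A (Multiplicative.ofAdd f) x = (x.1 + f x.2, x.2) := rfl

theorem s3P_sq (A : Type) [AddCommGroup A] (a : A) :
    (s3P A a) ^ 2 = s3T A (Multiplicative.ofAdd (fun _ => a)) := by
  rw [pow_two]
  ext ⟨x, c⟩ <;> cases c <;> simp [s3P, s3T_apply]

theorem s3_model (m n : ℕ) (hn : Even n) (A : Type) [AddCommGroup A] (a b e : A)
    (ha : m • a = e) (hb : n • b = e) (he : e + e = 0) :
    ∃ F : PresentedGroup (stmt3Rels (2 * m + 1) (n + 1)) →* Equiv.Perm (A × Bool),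
      F (PresentedGroup.of 1) = s3P A a ∧
      F (PresentedGroup.of 2) =
        s3T A (Multiplicative.ofAdd (fun c => b + if c then e else 0)) := by
  let g : Fin 3 → Equiv.Perm (A × Bool) :=
    ![s3T A (Multiplicative.ofAdd (fun _ => e)), s3P A a,
      s3T A (Multiplicative.ofAdd (fun c => b + if c then e else 0))]
  have h2m : s3P A a ^ (2 * m) = s3T A (Multiplicative.ofAdd (fun _ => e)) := by
    rw [pow_mul, s3P_sq, ← map_pow, ← ofAdd_nsmul]
    congr 2
    funext c
    simp [ha]
  have hnq : s3T A (Multiplicative.ofAdd (fun c => b + if c then e else 0)) ^ n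
      = s3T A (Multiplicative.ofAdd (fun _ => e)) := by
    rw [← map_pow, ← ofAdd_nsmul]
    congr 2
    funext c
    obtain ⟨k, rfl⟩ := hn
    cases c
    · simp [hb]
    · simp only [Pi.smul_apply, if_true, smul_add, hb]
      rw [add_smul, ← smul_add, he]; simp
  have he2 : s3T A (Multiplicative.ofAdd (fun _ => e)) ^ 2 = 1 := by
    rw [← map_pow, ← ofAdd_nsmul]
    have : (2 • (fun _ => e) : Bool → A) = 0 := by funext c; simp [two_nsmul, he]
    rw [this]; simp
  have H : ∀ r ∈ stmt3Rels (2 * m + 1) (n + 1), FreeGroup.lift g r = 1 := by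
    intro r hr
    simp only [stmt3Rels, Set.mem_insert_iff, Set.mem_singleton_iff, Nat.add_sub_cancel] at hr
    rcases hr with rfl | rfl | rfl | rfl | rfl | rfl | rfl | rfl
    · simpa [g] using he2
    · simp only [map_mul, map_inv, FreeGroup.lift_apply_of, g]
      simp only [Matrix.cons_val]
      rw [mul_inv_eq_one, mul_inv_eq_iff_eq_mul]
      ext ⟨x, c⟩ <;> cases c <;> simp [s3P, s3T_apply, add_comm, add_left_comm]
    · simp only [map_mul, map_inv, FreeGroup.lift_apply_of, g]
      simp only [Matrix.cons_val]
      rw [mul_inv_eq_one, mul_inv_eq_iff_eq_mul, ← map_mul (s3T A), ← map_mul (s3T A), mul_comm]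
    · simp only [map_pow, FreeGroup.lift_apply_of, g, Matrix.cons_val]
      rw [mul_comm, pow_mul, h2m, he2]
    · simp only [map_mul, map_inv, map_pow, FreeGroup.lift_apply_of, g, Matrix.cons_val]
      rw [h2m, mul_inv_cancel]
    · simp only [map_pow, FreeGroup.lift_apply_of, g, Matrix.cons_val]
      rw [mul_comm, pow_mul, hnq, he2]
    · simp only [map_mul, map_inv, map_pow, FreeGroup.lift_apply_of, g, Matrix.cons_val]
      rw [hnq, mul_inv_cancel]
    · simp only [map_mul, map_inv, FreeGroup.lift_apply_of, g]
      simp only [Matrix.cons_val]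
      rw [mul_inv_eq_one]
      have he3 : ∀ x : A, e + (e + x) = x := fun x => by rw [← add_assoc, he, zero_add]
      ext ⟨x, c⟩ <;> cases c <;> simp [s3P, s3T_apply, add_comm, add_left_comm, he3]
  exact ⟨PresentedGroup.toGroup H, by simp [g], by simp [g]⟩

theorem s3_main (m n d s t : ℕ) (α β : ℤ) (hn : Even n) (hd : 0 < d)
    (hm' : m = d * s) (hn' : n = d * t)
    (hdet : (t : ℤ) * β - s * α = 1)
    (N : Subgroup (PresentedGroup (stmt3Rels (2 * m + 1) (n + 1))))
    (hN : N = Subgroup.closure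
      {(PresentedGroup.of (rels := stmt3Rels (2 * m + 1) (n + 1)) 1) ^ 2, PresentedGroup.of 2}) :
    (∀ x y : N, x * y = y * x) ∧ N.index = 2 ∧
      Nonempty (N ≃* Multiplicative (ZMod d × ZMod (2 * s * n))) := by
  let A := ZMod d × ZMod (2 * s * n)
  let a : A := ((α : ZMod d), ((t : ℤ) : ZMod (2 * s * n)))
  let b : A := ((β : ZMod d), ((s : ℤ) : ZMod (2 * s * n)))
  have hzero : ∀ i j : ℤ, i • a + j • b = 0 ↔
      ((d : ℤ) ∣ i * α + j * β) ∧ ((2 * s * n : ℕ) : ℤ) ∣ i * t + j * s := by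
    intro i j
    rw [← ZMod.intCast_zmod_eq_zero_iff_dvd, ← ZMod.intCast_zmod_eq_zero_iff_dvd, Prod.ext_iff]
    simp only [a, b, Prod.fst_add, Prod.snd_add, Prod.smul_fst, Prod.smul_snd, zsmul_eq_mul,
      Prod.fst_zero, Prod.snd_zero]
    push_cast
    rfl
  obtain ⟨F, hF1, hF2⟩ := s3_model m n hn A a b (n • b)
    (by
      have := (hzero m (-n)).2 ⟨⟨s * α - t * β, by rw [hm', hn']; push_cast; ring⟩,
        ⟨0, by rw [hm', hn']; push_cast; ring⟩⟩
      simpa [← sub_eq_add_neg, sub_eq_zero] using this) rfl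
    (by
      have := (hzero 0 (2 * n)).2 ⟨⟨2 * t * β, by rw [hn']; push_cast; ring⟩,
        ⟨1, by push_cast; ring⟩⟩
      rw [← two_nsmul, smul_smul]
      simpa using (by exact_mod_cast this : (0 : ℤ) • a + (2 * n : ℕ) • b = 0))
  set G := PresentedGroup (stmt3Rels (2 * m + 1) (n + 1)) with hG
  let ε : G := PresentedGroup.of 0
  let P : G := PresentedGroup.of 1
  let Q : G := PresentedGroup.of 2
  have rel : ∀ r ∈ stmt3Rels (2 * m + 1) (n + 1),
    PresentedGroup.mk (stmt3Rels (2 * m + 1) (n + 1)) r = 1 := fun r hr =>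
      PresentedGroup.one_of_mem hr
  have r1 : ε ^ 2 = 1 := by
    have := rel ((FreeGroup.of 0) ^ 2) (by simp [stmt3Rels])
    rw [map_pow] at this
    exact this
  have r2 : ε * P = P * ε := by
    have := rel ((FreeGroup.of 0) * (FreeGroup.of 1) * (FreeGroup.of 0)⁻¹ * (FreeGroup.of 1)⁻¹)
      (by simp [stmt3Rels])
    rw [map_mul, map_inv, mul_inv_eq_one, map_mul, map_inv, mul_inv_eq_iff_eq_mul, map_mul] at this
    exact this
  have r3 : ε * Q = Q * ε := by
    have := rel ((FreeGroup.of 0) * (FreeGroup.of 2) * (FreeGroup.of 0)⁻¹ * (FreeGroup.of 2)⁻¹)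
      (by simp [stmt3Rels])
    rw [map_mul, map_inv, mul_inv_eq_one, map_mul, map_inv, mul_inv_eq_iff_eq_mul, map_mul] at this
    exact this
  have r4 : P ^ (2 * m) = ε := by
    have := rel ((FreeGroup.of 1) ^ (2 * m) * (FreeGroup.of 0)⁻¹) (by simp [stmt3Rels])
    rw [map_mul, map_inv, mul_inv_eq_one, map_pow] at this
    exact this
  have r5 : Q ^ n = ε := by
    have := rel ((FreeGroup.of 2) ^ n * (FreeGroup.of 0)⁻¹) (by simp [stmt3Rels])
    rw [map_mul, map_inv, mul_inv_eq_one, map_pow] at this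
    exact this
  have r6 : P * Q = Q * P * ε := by
    have := rel ((FreeGroup.of 1) * (FreeGroup.of 2) *
      ((FreeGroup.of 2) * (FreeGroup.of 1) * (FreeGroup.of 0))⁻¹) (by simp [stmt3Rels])
    rw [map_mul, map_inv, mul_inv_eq_one, map_mul, map_mul, map_mul] at this
    exact this
  have hcomm : Commute (P ^ 2) Q := by
    show P ^ 2 * Q = Q * P ^ 2
    calc P ^ 2 * Q = P * (P * Q) := by rw [pow_two, mul_assoc]
      _ = (P * Q) * P * ε := by conv_lhs => rw [r6]
                                simp only [mul_assoc]
      _ = Q * P * (ε * P) * ε := by rw [r6]; simp only [mul_assoc]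
      _ = Q * P ^ 2 * ε ^ 2 := by rw [r2]; simp only [mul_assoc, pow_two]
      _ = _ := by rw [r1, mul_one]
  have hPN : P ^ 2 ∈ N := by rw [hN]; exact Subgroup.subset_closure (by simp [P])
  have hQN : Q ∈ N := by rw [hN]; exact Subgroup.subset_closure (by simp [Q])
  let ψ : Multiplicative (ℤ × ℤ) →* N :=
    { toFun := fun z => ⟨(P ^ 2) ^ z.toAdd.1 * Q ^ z.toAdd.2,
        N.mul_mem (N.zpow_mem hPN _) (N.zpow_mem hQN _)⟩
      map_one' := by ext; simp
      map_mul' := fun x y => by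
        ext
        simp only [toAdd_mul, Prod.fst_add, Prod.snd_add, zpow_add, Subgroup.coe_mul]
        have := (hcomm.zpow_zpow y.toAdd.1 x.toAdd.2).eq
        simp only [mul_assoc]
        congr 1
        rw [← mul_assoc, this, mul_assoc] }
  have hψ : ∀ i j : ℤ, (ψ (Multiplicative.ofAdd (i, j)) : G) = (P ^ 2) ^ i * Q ^ j :=
    fun i j => rfl
  have hsurj : Function.Surjective ψ := by
    have : (⊤ : Subgroup N) ≤ ψ.range := by
      have h : N ≤ ψ.range.map N.subtype := by
        conv_lhs => rw [hN]
        rw [Subgroup.closure_le]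
        rintro x (rfl | rfl)
        · exact ⟨_, ⟨Multiplicative.ofAdd (1, 0), rfl⟩, by simp [hψ, P]⟩
        · exact ⟨_, ⟨Multiplicative.ofAdd (0, 1), rfl⟩, by simp [hψ, Q]⟩
      rintro ⟨x, hx⟩ -
      obtain ⟨y, hy, rfl⟩ := h hx
      exact hy
    intro x
    exact this (Subgroup.mem_top x)
  have hact : ∀ i j : ℤ, F ((P ^ 2) ^ i * Q ^ j) (0, false) = (i • a + j • b, false) := by
    intro i j
    rw [map_mul, map_zpow, map_zpow, map_pow, hF1, hF2, s3P_sq, ← map_zpow (s3T A), ← map_zpow (s3T A), ← map_mul (s3T A),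
      ← ofAdd_zsmul, ← ofAdd_zsmul, ← ofAdd_add, s3T_apply]
    simp
  have hker : ∀ i j : ℤ, (P ^ 2) ^ i * Q ^ j = 1 ↔ i • a + j • b = 0 := by
    intro i j
    constructor
    · intro h
      have := hact i j
      rw [h, map_one] at this
      simpa using (congrArg Prod.fst this).symm
    · intro h
      obtain ⟨⟨u, hu⟩, ⟨v, hv⟩⟩ := (hzero i j).1 h
      -- `(i, j) = x (m, -n) + y (0, 2n)`
      have hi : i = ((2 * m : ℕ) : ℤ) * v * t * β - m * u := by
        rw [hm']
        rw [hn'] at hv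
        push_cast at hv ⊢
        linear_combination (-i) * hdet + β * hv - s * hu
      have hj : j = n * (u - 2 * s * v * α) := by
        rw [hn']
        rw [hn'] at hv
        push_cast at hv ⊢
        linear_combination (-j) * hdet - α * hv + t * hu
      have hi2 : i = m * (2 * v * t * β - u) := by rw [hi]; push_cast; ring
      have hε : (P ^ 2) ^ (m : ℤ) = ε := by rw [zpow_natCast, ← pow_mul, r4]
      have hε' : Q ^ (n : ℤ) = ε := by rw [zpow_natCast, r5]
      rw [hi2, hj, zpow_mul, zpow_mul, hε, hε', ← zpow_add]
      have : 2 * v * t * β - u + (u - 2 * s * v * α) = (2 : ℕ) * v := by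
        push_cast
        linear_combination 2 * v * hdet
      rw [this, zpow_mul, zpow_natCast, r1, one_zpow]
  refine ⟨?_, ?_, ?_⟩
  · intro x y
    obtain ⟨x, rfl⟩ := hsurj x
    obtain ⟨y, rfl⟩ := hsurj y
    rw [← map_mul, ← map_mul, mul_comm x y]
  · have hεN : ε ∈ N := r5 ▸ N.pow_mem hQN n
    have hconj : ∀ x ∈ N, P * x * P⁻¹ ∈ N := by
      have h : N ≤ N.comap (MulAut.conj P).toMonoidHom := by
        conv_lhs => rw [hN]
        rw [Subgroup.closure_le]
        rintro x (rfl | rfl)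
        · show P * P ^ 2 * P⁻¹ ∈ N
          have : P * P ^ 2 * P⁻¹ = P ^ 2 := by group
          rwa [this]
        · show P * Q * P⁻¹ ∈ N
          have : P * Q * P⁻¹ = Q * ε := by rw [r6, mul_assoc Q, ← r2]; group
          rw [this]
          exact N.mul_mem hQN hεN
      intro x hx
      exact h hx
    have hconj' : ∀ x ∈ N, P⁻¹ * x * P ∈ N := by
      intro x hx
      have : P⁻¹ * x * P = (P ^ 2)⁻¹ * (P * x * P⁻¹) * P ^ 2 := by group
      rw [this]
      exact N.mul_mem (N.mul_mem (N.inv_mem hPN) (hconj x hx)) hPN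
    let K : Subgroup G :=
      { carrier := {g | g ∈ N ∨ g * P ∈ N}
        one_mem' := Or.inl N.one_mem
        mul_mem' := by
          rintro g h (hg | hg) (hh | hh)
          · exact Or.inl (N.mul_mem hg hh)
          · exact Or.inr (by rw [mul_assoc]; exact N.mul_mem hg hh)
          · refine Or.inr ?_
            have : g * h * P = (g * P) * (P⁻¹ * h * P) := by group
            rw [this]
            exact N.mul_mem hg (hconj' h hh)
          · refine Or.inl ?_
            have : g * h = (g * P) * (P⁻¹ * (h * P) * P) * (P ^ 2)⁻¹ := by group
            rw [this]
            exact N.mul_mem (N.mul_mem hg (hconj' _ hh)) (N.inv_mem hPN)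
        inv_mem' := by
          rintro g (hg | hg)
          · exact Or.inl (N.inv_mem hg)
          · refine Or.inr ?_
            have : g⁻¹ * P = (P * (g * P)⁻¹ * P⁻¹) * P ^ 2 := by group
            rw [this]
            exact N.mul_mem (hconj _ (N.inv_mem hg)) hPN }
    have hK : ∀ g : G, g ∈ N ∨ g * P ∈ N := by
      have : (⊤ : Subgroup G) ≤ K := by
        rw [← PresentedGroup.closure_range_of, Subgroup.closure_le]
        rintro _ ⟨i, rfl⟩
        fin_cases i
        · exact Or.inl hεN
        · exact Or.inr (by have := hPN; rw [pow_two] at this; exact this)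
        · exact Or.inl hQN
      intro g
      exact this (Subgroup.mem_top g)
    have hPn : P ∉ N := by
      intro h
      obtain ⟨z, hz⟩ := hsurj ⟨P, h⟩
      have h1 := hact z.toAdd.1 z.toAdd.2
      have h2 : (P ^ 2) ^ z.toAdd.1 * Q ^ z.toAdd.2 = P := congrArg Subtype.val hz
      rw [h2, hF1] at h1
      simpa [s3P] using congrArg Prod.snd h1
    rw [Subgroup.index_eq_two_iff]
    refine ⟨P, fun g => ?_⟩
    rcases hK g with h | h
    · exact Or.inr ⟨h, fun h' => hPn ((N.mul_mem_cancel_left h).1 h')⟩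
    · exact Or.inl ⟨h, fun h' => hPn ((N.mul_mem_cancel_left h').1 h)⟩
  · let φ : Multiplicative (ℤ × ℤ) →* Multiplicative A :=
      AddMonoidHom.toMultiplicative
        { toFun := fun z => z.1 • a + z.2 • b
          map_zero' := by simp
          map_add' := fun x y => by simp only [Prod.fst_add, Prod.snd_add, add_smul]; abel }
    have hφ : Function.Surjective φ := by
      intro w
      obtain ⟨x, hx⟩ := ZMod.intCast_surjective w.toAdd.1
      obtain ⟨y, hy⟩ := ZMod.intCast_surjective w.toAdd.2
      refine ⟨Multiplicative.ofAdd (β * y - s * x, t * x - α * y), ?_⟩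
      show Multiplicative.ofAdd ((β * y - s * x) • a + (t * x - α * y) • b) = w
      apply Multiplicative.toAdd.injective
      rw [toAdd_ofAdd]
      refine Prod.ext ?_ ?_
      · rw [← hx]
        show (β * y - s * x) • (α : ZMod d) + (t * x - α * y) • (β : ZMod d) = (x : ZMod d)
        rw [zsmul_eq_mul, zsmul_eq_mul, ← Int.cast_mul, ← Int.cast_mul, ← Int.cast_add]
        congr 1
        linear_combination x * hdet
      · rw [← hy]
        show (β * y - s * x) • ((t : ℤ) : ZMod (2 * s * n)) +
          (t * x - α * y) • ((s : ℤ) : ZMod (2 * s * n)) = (y : ZMod (2 * s * n))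
        rw [zsmul_eq_mul, zsmul_eq_mul, ← Int.cast_mul, ← Int.cast_mul, ← Int.cast_add]
        congr 1
        linear_combination y * hdet
    have hk : ψ.ker = φ.ker := by
      ext z
      rw [MonoidHom.mem_ker, MonoidHom.mem_ker, Subtype.ext_iff]
      exact hker z.toAdd.1 z.toAdd.2
    exact ⟨(QuotientGroup.quotientKerEquivOfSurjective ψ hsurj).symm.trans
      ((QuotientGroup.quotientMulEquivOfEq hk).trans
        (QuotientGroup.quotientKerEquivOfSurjective φ hφ))⟩

theorem stmt_3 (p q : ℕ) (hp : p.Prime) (hq : q.Prime) (hp2 : p ≠ 2) (hq2 : q ≠ 2)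
    (hpq : p ≠ q) (hv : padicValNat 2 (p - 1) ≤ padicValNat 2 (q - 1))
    (d s : ℕ) (hd : d = Nat.gcd ((p - 1) / 2) (q - 1)) (hs : s = (p - 1) / (2 * d))
    (N : Subgroup (PresentedGroup (stmt3Rels p q)))
    (hN : N = Subgroup.closure
      {(PresentedGroup.of (rels := stmt3Rels p q) 1) ^ 2, PresentedGroup.of 2}) :
    (∀ x y : N, x * y = y * x) ∧ N.index = 2 ∧
      Nonempty (N ≃* Multiplicative (ZMod d × ZMod (2 * s * (q - 1)))) := by
  obtain ⟨m, rfl⟩ := hp.odd_of_ne_two hp2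
  obtain ⟨k, rfl⟩ := hq.odd_of_ne_two hq2
  have hm0 : 0 < m := by
    rcases Nat.eq_zero_or_pos m with rfl | h
    · exact absurd hp (by norm_num)
    · exact h
  have e1 : (2 * m + 1 - 1) / 2 = m := by omega
  rw [e1, Nat.add_sub_cancel] at hd
  have hd0 : 0 < d := by rw [hd]; exact Nat.gcd_pos_of_pos_left _ hm0
  obtain ⟨s', hs'⟩ : d ∣ m := hd ▸ Nat.gcd_dvd_left _ _
  obtain ⟨t, ht⟩ : d ∣ 2 * k := hd ▸ Nat.gcd_dvd_right _ _
  have hss : s = s' := by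
    rw [hs, Nat.add_sub_cancel, hs', ← mul_assoc]
    exact Nat.mul_div_cancel_left _ (by omega)
  subst hss
  have hb : (d : ℤ) = m * Nat.gcdA m (2 * k) + (2 * k : ℕ) * Nat.gcdB m (2 * k) := by
    rw [← Nat.gcd_eq_gcd_ab, ← hd]
  refine s3_main m (2 * k) d s t (-Nat.gcdA m (2 * k)) (Nat.gcdB m (2 * k)) (even_two_mul k) hd0
    hs' ht ?_ N hN
  generalize Nat.gcdA m (2 * k) = x at *
  generalize Nat.gcdB m (2 * k) = y at *
  rw [ht, hs'] at hb
  have hdz : (d : ℤ) ≠ 0 := by positivity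
  apply mul_left_cancel₀ hdz
  push_cast at hb
  linarith
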